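/- arXiv:2012.05329 — 2 statements merged into one kernel-verified Lean document; each statement's English description precedes it below -/
import Mathlib

section
/- Let K ≥ 1, and for each k ∈ {1,…,K} let V^{(k)} ∈ ℝ^{C×D} have no zero entries and pairwise distinct entries in its d-th column, and let a^{(k)} ∈ ℝ^C. Let x' ∈ ℝ^D with x'_d ≠ 0, let p̄_c(x) = (1/K) Σ_{k=1}^{K} softmax(V^{(k)} x + a^{(k)})_c, and define the approximate mutual information I(x) = H(p̄(x)) − (1/K) Σ_{k=1}^{K} H(softmax(V^{(k)} x + a^{(k)})), where H(p) = −Σ_{c=1}^{C} p_c log p_c. Then the Euclidean norm of the gradient of I evaluated at the scaled point x_α tends to 0 as α → ∞. -/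
/-- The softmax function on `ℝ^C`. -/
noncomputable def softmax {C : ℕ} (z : Fin C → ℝ) : Fin C → ℝ :=
  fun c => Real.exp (z c) / ∑ c', Real.exp (z c')

/-- The point `x'` scaled by `α` in coordinate `d` (all other coordinates unchanged). -/
def scaled {D : ℕ} (x' : Fin D → ℝ) (d : Fin D) (α : ℝ) : Fin D → ℝ :=
  Function.update x' d (α * x' d)

/-- Shannon entropy of a vector of probabilities. -/
noncomputable def shannonEntropy {C : ℕ} (p : Fin C → ℝ) : ℝ :=
  -∑ c : Fin C, p c * Real.log (p c)

/-- The averaged predictive distribution of `K` softmax-affine model instances. -/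
noncomputable def avgPred {D C K : ℕ} (V : Fin K → Matrix (Fin C) (Fin D) ℝ)
    (a : Fin K → Fin C → ℝ) (x : Fin D → ℝ) (c : Fin C) : ℝ :=
  (1 / (K : ℝ)) * ∑ k : Fin K, softmax ((V k).mulVec x + a k) c

open Filter Topology

theorem softmax_pos {C : ℕ} (z : Fin C → ℝ) (c : Fin C) : 0 < softmax z c :=
  div_pos (Real.exp_pos _)
    (Finset.sum_pos (fun _ _ => Real.exp_pos _) ⟨c, Finset.mem_univ c⟩)

theorem softmax_le_exp_sub {C : ℕ} (z : Fin C → ℝ) (c j : Fin C) :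
    softmax z c ≤ Real.exp (z c - z j) := by
  rw [Real.exp_sub]
  exact div_le_div_of_nonneg_left (Real.exp_pos _).le (Real.exp_pos _)
    (Finset.single_le_sum (f := fun i => Real.exp (z i)) (fun _ _ => (Real.exp_pos _).le)
      (Finset.mem_univ j))

theorem softmax_le_one {C : ℕ} (z : Fin C → ℝ) (c : Fin C) : softmax z c ≤ 1 := by
  simpa using softmax_le_exp_sub z c c

theorem softmax_eq_inv_sum {C : ℕ} (z : Fin C → ℝ) (c : Fin C) :
    softmax z c = (∑ j, Real.exp (z j - z c))⁻¹ := by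
  simp only [Real.exp_sub, ← Finset.sum_div, inv_div, softmax]

theorem hasFDerivAt_softmax {E : Type*} [NormedAddCommGroup E] [NormedSpace ℝ E] {C : ℕ}
    {z : E → Fin C → ℝ} {L : Fin C → E →L[ℝ] ℝ} {x : E}
    (hz : ∀ c, HasFDerivAt (fun y => z y c) (L c) x) (c : Fin C) :
    HasFDerivAt (fun y => softmax (z y) c)
      (∑ j, (softmax (z x) c * softmax (z x) j) • (L c - L j)) x := by
  have hS : ∑ j, Real.exp (z x j - z x c) ≠ 0 :=
    (Finset.sum_pos (fun _ _ => Real.exp_pos _) ⟨c, Finset.mem_univ c⟩).ne'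
  have h : HasFDerivAt (fun y => ∑ j, Real.exp (z y j - z y c))
      (∑ j, Real.exp (z x j - z x c) • (L j - L c)) x :=
    HasFDerivAt.fun_sum fun j _ => ((hz j).sub (hz c)).exp
  have h' := (hasDerivAt_inv hS).comp_hasFDerivAt x h
  simp only [softmax_eq_inv_sum]
  refine h'.congr_fderiv ?_
  rw [Finset.smul_sum]
  refine Finset.sum_congr rfl fun j _ => ?_
  have hj : softmax (z x) j = softmax (z x) c * Real.exp (z x j - z x c) := by
    rw [softmax, softmax, Real.exp_sub]
    field_simp
  rw [← softmax_eq_inv_sum, ← softmax_eq_inv_sum, hj, smul_smul, ← neg_sub (L j) (L c), smul_neg,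
    ← neg_smul, softmax_eq_inv_sum]
  congr 1
  ring

theorem tendsto_softmax_mul_softmax {C : ℕ} (b s : Fin C → ℝ) {c j : Fin C} (h : s c ≠ s j) :
    Tendsto (fun α : ℝ => softmax (fun i => b i + α * s i) c * softmax (fun i => b i + α * s i) j)
      atTop (𝓝 0) := by
  have key : ∀ {c j : Fin C}, s c < s j →
      Tendsto (fun α : ℝ => softmax (fun i => b i + α * s i) c *
        softmax (fun i => b i + α * s i) j) atTop (𝓝 0) := by
    intro c j h
    have hlim : Tendsto (fun α : ℝ => Real.exp ((b c + α * s c) - (b j + α * s j)))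
        atTop (𝓝 0) := by
      refine Real.tendsto_exp_atBot.comp ?_
      have : Tendsto (fun α : ℝ => (b c - b j) + α * (s c - s j)) atTop atBot :=
        tendsto_atBot_add_const_left _ _ (tendsto_id.atTop_mul_const_of_neg (sub_neg.2 h))
      exact this.congr fun α => by ring
    refine squeeze_zero (fun α => (mul_pos (softmax_pos _ _) (softmax_pos _ _)).le)
      (fun α => ?_) hlim
    exact (mul_le_of_le_one_right (softmax_pos _ _).le (softmax_le_one _ _)).trans
      (softmax_le_exp_sub _ c j)
  rcases lt_or_gt_of_ne h with h | h
  · exact key h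
  · simpa only [mul_comm] using key h

theorem tendsto_mul_log_of_le {ι : Type*} {l : Filter ι} {q r : ι → ℝ} {M : ℝ} (hM : 0 < M)
    (hq : Tendsto q l (𝓝 0)) (hq0 : ∀ i, 0 < q i) (hqr : ∀ i, q i ≤ M * r i) (hr : ∀ i, r i ≤ 1) :
    Tendsto (fun i => q i * Real.log (r i)) l (𝓝 0) := by
  have hlim : Tendsto (fun i => M * Real.negMulLog (q i / M)) l (𝓝 0) := by
    have h := (Real.continuous_negMulLog.tendsto 0).comp
      (by simpa using hq.div_const M : Tendsto (fun i => q i / M) l (𝓝 0))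
    simpa using h.const_mul M
  refine squeeze_zero_norm (fun i => ?_) hlim
  have hle : q i / M ≤ r i := by rw [div_le_iff₀' hM]; exact hqr i
  have hpos : 0 < q i / M := div_pos (hq0 i) hM
  have hlog : Real.log (r i) ≤ 0 := Real.log_nonpos (hpos.le.trans hle) (hr i)
  rw [Real.norm_eq_abs, abs_mul, abs_of_pos (hq0 i), abs_of_nonpos hlog, Real.negMulLog]
  calc q i * -Real.log (r i) ≤ q i * -Real.log (q i / M) := by
        gcongr
        exact (hq0 i).le
    _ = M * (-(q i / M) * Real.log (q i / M)) := by field_simp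

theorem hasFDerivAt_shannonEntropy {E : Type*} [NormedAddCommGroup E] [NormedSpace ℝ E] {C : ℕ}
    {p : E → Fin C → ℝ} {T : Fin C → E →L[ℝ] ℝ} {x : E}
    (hp : ∀ c, HasFDerivAt (fun y => p y c) (T c) x) (hp0 : ∀ c, p x c ≠ 0) :
    HasFDerivAt (fun y => shannonEntropy (p y))
      (∑ c, (-Real.log (p x c) - 1) • T c) x := by
  have h : HasFDerivAt (fun y => ∑ c, Real.negMulLog (p y c))
      (∑ c, (-Real.log (p x c) - 1) • T c) x :=
    HasFDerivAt.fun_sum fun c _ =>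
      HasDerivAt.comp_hasFDerivAt (f := fun y => p y c) x (Real.hasDerivAt_negMulLog (hp0 c)) (hp c)
  refine h.congr_of_eventuallyEq (Eventually.of_forall fun y => ?_)
  simp [shannonEntropy, Real.negMulLog]

theorem softmax_le_mul_avgPred {D C K : ℕ} (V : Fin K → Matrix (Fin C) (Fin D) ℝ)
    (a : Fin K → Fin C → ℝ) (x : Fin D → ℝ) (c : Fin C) (k : Fin K) :
    softmax ((V k).mulVec x + a k) c ≤ K * avgPred V a x c := by
  have hK : (K : ℝ) ≠ 0 := Nat.cast_ne_zero.2 k.pos.ne'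
  rw [avgPred, ← mul_assoc, mul_one_div_cancel hK, one_mul]
  exact Finset.single_le_sum (f := fun k => softmax ((V k).mulVec x + a k) c)
    (fun _ _ => (softmax_pos _ _).le) (Finset.mem_univ k)

theorem avgPred_le_one {D C K : ℕ} (V : Fin K → Matrix (Fin C) (Fin D) ℝ)
    (a : Fin K → Fin C → ℝ) (x : Fin D → ℝ) (c : Fin C) : avgPred V a x c ≤ 1 := by
  have h : ∑ k : Fin K, softmax ((V k).mulVec x + a k) c ≤ K := by
    simpa using Finset.sum_le_card_nsmul Finset.univ
      (fun k => softmax ((V k).mulVec x + a k) c) 1 fun k _ => softmax_le_one _ _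
  rw [avgPred, one_div_mul_eq_div]
  exact div_le_one_of_le₀ h (Nat.cast_nonneg K)

theorem avgPred_pos {D C K : ℕ} (hK : 1 ≤ K) (V : Fin K → Matrix (Fin C) (Fin D) ℝ)
    (a : Fin K → Fin C → ℝ) (x : Fin D → ℝ) (c : Fin C) : 0 < avgPred V a x c :=
  pos_of_mul_pos_right ((softmax_pos _ c).trans_le (softmax_le_mul_avgPred V a x c ⟨0, hK⟩))
    (Nat.cast_nonneg K)

theorem mulVec_scaled_add {D C : ℕ} (V : Matrix (Fin C) (Fin D) ℝ) (a : Fin C → ℝ)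
    (x' : Fin D → ℝ) (d : Fin D) (α : ℝ) :
    V.mulVec (scaled x' d α) + a =
      fun c => (V.mulVec (scaled x' d 0) c + a c) + α * (V c d * x' d) := by
  have h : scaled x' d α = scaled x' d 0 + Pi.single d (α * x' d) := by
    ext i
    by_cases hi : i = d
    · subst hi; simp [scaled]
    · simp [scaled, hi]
  ext c
  rw [h, Matrix.mulVec_add, Matrix.mulVec_single]
  simp
  ring

/-- The derivative of the `c`-th logit of an affine map with matrix `V`. -/
noncomputable def rowCLM {D C : ℕ} (V : Matrix (Fin C) (Fin D) ℝ) (c : Fin C) :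
    EuclideanSpace ℝ (Fin D) →L[ℝ] ℝ :=
  ∑ i, V c i • EuclideanSpace.proj i

theorem hasFDerivAt_mulVec_add {D C : ℕ} (V : Matrix (Fin C) (Fin D) ℝ) (a : Fin C → ℝ)
    (x : EuclideanSpace ℝ (Fin D)) (c : Fin C) :
    HasFDerivAt (fun y : EuclideanSpace ℝ (Fin D) =>
      (V.mulVec (WithLp.equiv 2 (Fin D → ℝ) y) + a) c) (rowCLM V c) x := by
  refine ((rowCLM V c).hasFDerivAt.add_const (a c)).congr_of_eventuallyEq
    (Eventually.of_forall fun y => ?_)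
  simp [rowCLM, Matrix.mulVec, dotProduct]

theorem stmt_8 (D C K : ℕ) (hC : 1 ≤ C) (hK : 1 ≤ K)
    (V : Fin K → Matrix (Fin C) (Fin D) ℝ) (a : Fin K → Fin C → ℝ) (d : Fin D)
    (hV : ∀ k c d', V k c d' ≠ 0)
    (hcol : ∀ k, Function.Injective fun c => V k c d)
    (x' : Fin D → ℝ) (hx' : x' d ≠ 0) :
    Filter.Tendsto
      (fun α : ℝ =>
        ‖gradient
            (fun x : EuclideanSpace ℝ (Fin D) =>
              shannonEntropy (avgPred V a (WithLp.equiv 2 (Fin D → ℝ) x)) -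
                (1 / (K : ℝ)) *
                  ∑ k : Fin K,
                    shannonEntropy (softmax ((V k).mulVec (WithLp.equiv 2 (Fin D → ℝ) x) + a k)))
            ((WithLp.equiv 2 (Fin D → ℝ)).symm (scaled x' d α))‖)
      Filter.atTop (nhds 0) := by
  have hinner : ∀ k c j, ∀ r : ℝ → ℝ,
      (c ≠ j → Tendsto (fun α : ℝ => r α * (softmax ((V k).mulVec (scaled x' d α) + a k) c *
        softmax ((V k).mulVec (scaled x' d α) + a k) j)) atTop (𝓝 0)) →
      Tendsto (fun α : ℝ => r α • (softmax ((V k).mulVec (scaled x' d α) + a k) c *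
        softmax ((V k).mulVec (scaled x' d α) + a k) j) • (rowCLM (V k) c - rowCLM (V k) j))
        atTop (𝓝 0) := by
    intro k c j r h
    rcases eq_or_ne c j with rfl | hcj
    · simp
    · simpa only [smul_smul, zero_smul] using (h hcj).smul_const (rowCLM (V k) c - rowCLM (V k) j)
  have hq : ∀ k c j, c ≠ j → Tendsto (fun α : ℝ =>
      softmax ((V k).mulVec (scaled x' d α) + a k) c *
        softmax ((V k).mulVec (scaled x' d α) + a k) j) atTop (𝓝 0) := by
    intro k c j hcj
    simp only [mulVec_scaled_add (V k) (a k) x' d]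
    refine tendsto_softmax_mul_softmax _ _ fun h => hcj (hcol k ?_)
    exact mul_right_cancel₀ hx' h
  have hlog : ∀ k c (r : ℝ → ℝ) (M : ℝ), 0 < M →
      (∀ α, softmax ((V k).mulVec (scaled x' d α) + a k) c ≤ M * r α) → (∀ α, r α ≤ 1) →
      Tendsto (fun α : ℝ => (-Real.log (r α) - 1) •
        ∑ j, (softmax ((V k).mulVec (scaled x' d α) + a k) c *
          softmax ((V k).mulVec (scaled x' d α) + a k) j) • (rowCLM (V k) c - rowCLM (V k) j))
        atTop (𝓝 0) := by
    intro k c r M hM hle hr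
    simp only [Finset.smul_sum]
    rw [← Finset.sum_const_zero (s := (Finset.univ : Finset (Fin C)))]
    refine tendsto_finsetSum _ fun j _ => hinner k c j _ fun hcj => ?_
    have h := tendsto_mul_log_of_le hM (hq k c j hcj)
      (fun α => mul_pos (softmax_pos _ _) (softmax_pos _ _))
      (fun α => (mul_le_of_le_one_right (softmax_pos _ _).le (softmax_le_one _ _)).trans (hle α)) hr
    have h' := h.neg.sub (hq k c j hcj)
    rw [neg_zero, sub_zero] at h'
    exact h'.congr fun α => by ring
  have hsoft : ∀ (x : EuclideanSpace ℝ (Fin D)) k c, HasFDerivAt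
      (fun y : EuclideanSpace ℝ (Fin D) =>
        softmax ((V k).mulVec (WithLp.equiv 2 (Fin D → ℝ) y) + a k) c) _ x :=
    fun x k c => hasFDerivAt_softmax (hasFDerivAt_mulVec_add (V k) (a k) x) c
  have hderiv := fun x : EuclideanSpace ℝ (Fin D) =>
    (hasFDerivAt_shannonEntropy
      (p := fun y : EuclideanSpace ℝ (Fin D) => avgPred V a (WithLp.equiv 2 (Fin D → ℝ) y))
      (fun c => (HasFDerivAt.fun_sum fun k (_ : k ∈ Finset.univ) => hsoft x k c).const_mul
        (1 / (K : ℝ)))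
      (fun c => (avgPred_pos hK V a _ c).ne')).sub
    ((HasFDerivAt.fun_sum fun k (_ : k ∈ Finset.univ) =>
      hasFDerivAt_shannonEntropy (hsoft x k) fun c => (softmax_pos _ c).ne').const_mul
        (1 / (K : ℝ)))
  have hgrad := fun x => (congrArg norm (hderiv x).hasGradientAt.gradient).trans
    (LinearIsometryEquiv.norm_map _ _)
  refine (tendsto_congr fun α => hgrad _).2 ?_
  rw [← norm_zero (E := EuclideanSpace ℝ (Fin D) →L[ℝ] ℝ)]
  refine Tendsto.norm ?_
  simp only [Equiv.apply_symm_apply]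
  have hK' : (0 : ℝ) < K := Nat.cast_pos.2 hK
  have h₁ : Tendsto (fun α : ℝ => ∑ c, (-Real.log (avgPred V a (scaled x' d α) c) - 1) •
      (1 / (K : ℝ)) • ∑ k, ∑ j, (softmax ((V k).mulVec (scaled x' d α) + a k) c *
        softmax ((V k).mulVec (scaled x' d α) + a k) j) • (rowCLM (V k) c - rowCLM (V k) j))
      atTop (𝓝 0) := by
    rw [← Finset.sum_const_zero (s := (Finset.univ : Finset (Fin C)))]
    refine tendsto_finsetSum _ fun c _ => ?_
    simp only [smul_comm _ (1 / (K : ℝ))]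
    rw [← smul_zero (1 / (K : ℝ))]
    refine Tendsto.const_smul ?_ _
    simp only [Finset.smul_sum (s := (Finset.univ : Finset (Fin K)))]
    rw [← Finset.sum_const_zero (s := (Finset.univ : Finset (Fin K)))]
    exact tendsto_finsetSum _ fun k _ => hlog k c _ K hK'
      (fun α => softmax_le_mul_avgPred V a _ c k) fun α => avgPred_le_one V a _ c
  have h₂ : Tendsto (fun α : ℝ => (1 / (K : ℝ)) • ∑ k, ∑ c,
      (-Real.log (softmax ((V k).mulVec (scaled x' d α) + a k) c) - 1) •
        ∑ j, (softmax ((V k).mulVec (scaled x' d α) + a k) c *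
          softmax ((V k).mulVec (scaled x' d α) + a k) j) • (rowCLM (V k) c - rowCLM (V k) j))
      atTop (𝓝 0) := by
    rw [← smul_zero (1 / (K : ℝ))]
    refine Tendsto.const_smul ?_ _
    rw [← Finset.sum_const_zero (s := (Finset.univ : Finset (Fin K)))]
    refine tendsto_finsetSum _ fun k _ => ?_
    rw [← Finset.sum_const_zero (s := (Finset.univ : Finset (Fin C)))]
    exact tendsto_finsetSum _ fun c _ => hlog k c _ 1 one_pos
      (fun α => (one_mul _).ge) fun α => softmax_le_one _ c
  simpa only [sub_zero] using h₁.sub h₂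
end

section
/- Let K ≥ 1, and for each k ∈ {1,…,K} let V^{(k)} ∈ ℝ^{C×D} have no zero entries and pairwise distinct entries in its d-th column, and let a^{(k)} ∈ ℝ^C. Let x' ∈ ℝ^D with x'_d ≠ 0, let p̄_c(x) = (1/K) Σ_{k=1}^{K} softmax(V^{(k)} x + a^{(k)})_c, and define the predictive entropy E(x) = −Σ_{c=1}^{C} p̄_c(x) log p̄_c(x). Then the predictive entropy converges to a fixed value: there exists L ∈ ℝ such that E(x_α) → L as α → ∞. -/
open Filter Topology

theorem softmax_eq_inv_sum_exp_sub {C : ℕ} (z : Fin C → ℝ) (c : Fin C) :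
    softmax z c = (∑ c', Real.exp (z c' - z c))⁻¹ := by
  simp only [softmax, Real.exp_sub, ← Finset.sum_div, inv_div]

theorem exists_tendsto_exp_affine {s : ℝ} (hs : s ≤ 0) (b : ℝ) :
    ∃ l, 0 ≤ l ∧ Tendsto (fun α : ℝ => Real.exp (α * s + b)) atTop (𝓝 l) := by
  rcases hs.lt_or_eq with hs | rfl
  · exact ⟨0, le_rfl, Real.tendsto_exp_atBot.comp
      (tendsto_atBot_add_const_right _ b (tendsto_id.atTop_mul_const_of_neg hs))⟩
  · exact ⟨Real.exp b, (Real.exp_pos b).le, by simp⟩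

/-- Each softmax coordinate converges along a ray, even when the largest slope is not unique. -/
theorem exists_tendsto_softmax_affine {C : ℕ} (s b : Fin C → ℝ) (c : Fin C) :
    ∃ l, Tendsto (fun α : ℝ => softmax (fun c' => α * s c' + b c') c) atTop (𝓝 l) := by
  have key (α : ℝ) : softmax (fun c' => α * s c' + b c') c =
      (∑ c', Real.exp (α * (s c' - s c) + (b c' - b c)))⁻¹ := by
    rw [softmax_eq_inv_sum_exp_sub]
    congr! 3
    ring
  simp only [key]
  by_cases h : ∀ c', s c' ≤ s c
  · choose l hl0 hl using fun c' =>
      exists_tendsto_exp_affine (sub_nonpos.2 (h c')) (b c' - b c)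
    have hlc : l c = 1 := tendsto_nhds_unique (hl c) (by simp)
    have hpos : 0 < ∑ c', l c' :=
      Finset.sum_pos' (fun c' _ => hl0 c') ⟨c, Finset.mem_univ c, by simp [hlc]⟩
    exact ⟨_, (tendsto_finsetSum _ fun c' _ => hl c').inv₀ hpos.ne'⟩
  · push Not at h
    obtain ⟨m, hm⟩ := h
    have hexp : Tendsto (fun α : ℝ => Real.exp (α * (s m - s c) + (b m - b c))) atTop atTop :=
      Real.tendsto_exp_atTop.comp
        (tendsto_atTop_add_const_right _ _ (tendsto_id.atTop_mul_const (sub_pos.2 hm)))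
    refine ⟨0, tendsto_inv_atTop_zero.comp (tendsto_atTop_mono (fun α => ?_) hexp)⟩
    exact Finset.single_le_sum
      (f := fun c' => Real.exp (α * (s c' - s c) + (b c' - b c)))
      (fun c' _ => (Real.exp_pos _).le) (Finset.mem_univ m)

theorem mulVec_scaled {C D : ℕ} (V : Matrix (Fin C) (Fin D) ℝ) (x' : Fin D → ℝ) (d : Fin D)
    (α : ℝ) (c : Fin C) :
    V.mulVec (scaled x' d α) c =
      α * (V c d * x' d) + V.mulVec (Function.update x' d 0) c := by
  have h : scaled x' d α = Pi.single d (α * x' d) + Function.update x' d 0 := by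
    ext j
    by_cases hj : j = d
    · subst hj
      simp [scaled]
    · simp [scaled, hj]
  rw [h, Matrix.mulVec_add, Pi.add_apply, Matrix.mulVec_single]
  simp [Matrix.col_apply]
  ring

theorem exists_tendsto_avgPred_scaled {D C K : ℕ} (V : Fin K → Matrix (Fin C) (Fin D) ℝ)
    (a : Fin K → Fin C → ℝ) (x' : Fin D → ℝ) (d : Fin D) (c : Fin C) :
    ∃ l, Tendsto (fun α : ℝ => avgPred V a (scaled x' d α) c) atTop (𝓝 l) := by
  choose l hl using fun k => exists_tendsto_softmax_affine (fun c' => V k c' d * x' d)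
    (fun c' => (V k).mulVec (Function.update x' d 0) c' + a k c') c
  refine ⟨_, (tendsto_finsetSum Finset.univ fun k _ => hl k).const_mul (1 / (K : ℝ)) |>.congr
    fun α => ?_⟩
  simp only [avgPred]
  congr! 3 with k
  ext c'
  rw [Pi.add_apply, mulVec_scaled, add_assoc]


theorem stmt_11 (D C K : ℕ) (hC : 1 ≤ C) (hK : 1 ≤ K)
    (V : Fin K → Matrix (Fin C) (Fin D) ℝ) (a : Fin K → Fin C → ℝ) (d : Fin D)
    (hV : ∀ k c d', V k c d' ≠ 0)
    (hcol : ∀ k, Function.Injective fun c => V k c d)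
    (x' : Fin D → ℝ) (hx' : x' d ≠ 0) :
    ∃ L : ℝ,
      Filter.Tendsto
        (fun α : ℝ =>
          -∑ c : Fin C,
              avgPred V a (scaled x' d α) c * Real.log (avgPred V a (scaled x' d α) c))
        Filter.atTop (nhds L) := by
  choose l hl using exists_tendsto_avgPred_scaled V a x' d
  exact ⟨_, (tendsto_finsetSum Finset.univ fun c _ =>
    (Real.continuous_mul_log.tendsto (l c)).comp (hl c)).neg⟩
end
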